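/- Let p, q, r be pairwise coprime prime powers, each > 1. Then Ψ*_{pqr}(X) = Φ*_{pq}(X) · Ψ*_{pq}(X^r) in ℤ[X], where Ψ*_{pq}(X^r) denotes the composition of Ψ*_{pq} with X^r. -/

import Mathlib

open Polynomial

/-- The unitary cyclotomic polynomial `Φ*_n = ∏_{d ∣ n, rad(d) = rad(n)} Φ_d`. -/
noncomputable def unitaryCyclotomic (n : ℕ) : Polynomial ℤ :=
  ∏ d ∈ n.divisors.filter (fun d => d.primeFactors = n.primeFactors), cyclotomic d ℤ

/-- The inverse unitary cyclotomic polynomial `Ψ*_n`, satisfying `Φ*_n · Ψ*_n = X^n − 1`. -/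
noncomputable def unitaryCyclotomicInv (n : ℕ) : Polynomial ℤ :=
  (X ^ n - 1) /ₘ unitaryCyclotomic n

theorem unitaryCyclotomic_monic (n : ℕ) : (unitaryCyclotomic n).Monic :=
  monic_prod_of_monic _ _ fun d _ => cyclotomic.monic d ℤ

theorem unitaryCyclotomic_mul_unitaryCyclotomicInv {n : ℕ} (hn : 0 < n) :
    unitaryCyclotomic n * unitaryCyclotomicInv n = X ^ n - 1 := by
  have hdvd : unitaryCyclotomic n ∣ X ^ n - 1 := by
    rw [← prod_cyclotomic_eq_X_pow_sub_one hn]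
    exact Finset.prod_dvd_prod_of_subset _ _ _ (Finset.filter_subset _ _)
  have h := modByMonic_add_div (X ^ n - 1) (unitaryCyclotomic n)
  rwa [(modByMonic_eq_zero_iff_dvd (unitaryCyclotomic_monic n)).2 hdvd, zero_add] at h

theorem expand_prime_pow_cyclotomic {s d : ℕ} (hs : s.Prime) (hd : ¬ s ∣ d) (k : ℕ) :
    expand ℤ (s ^ k) (cyclotomic d ℤ) = ∏ i ∈ Finset.range (k + 1), cyclotomic (d * s ^ i) ℤ := by
  induction k with
  | zero => simp
  | succ k ih =>
    have hstep : ∀ i, expand ℤ s (cyclotomic (d * s ^ (i + 1)) ℤ) =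
        cyclotomic (d * s ^ (i + 1 + 1)) ℤ := fun i => by
      rw [cyclotomic_expand_eq_cyclotomic hs (Dvd.intro_left _ (by ring : d * s ^ i * s = _))]
      ring_nf
    rw [pow_succ', expand_mul, ih, map_prod, Finset.prod_range_succ',
      Finset.prod_congr rfl fun i _ => hstep i, pow_zero, mul_one,
      cyclotomic_expand_eq_cyclotomic_mul hs hd, Finset.prod_range_succ' _ (k + 1),
      Finset.prod_range_succ' _ k]
    simp [mul_assoc]

theorem unitaryCyclotomic_mul_prime_pow {s m k : ℕ} (hs : s.Prime) (hm : m ≠ 0) (hsm : ¬ s ∣ m)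
    (hk : k ≠ 0) :
    unitaryCyclotomic (m * s ^ k) =
      ∏ d ∈ m.divisors.filter (fun d => d.primeFactors = m.primeFactors),
        ∏ i ∈ Finset.range k, cyclotomic (d * s ^ (i + 1)) ℤ := by
  have hs' : s ∉ m.primeFactors := fun h => hsm (Nat.dvd_of_mem_primeFactors h)
  have hpf : ∀ {a j : ℕ}, a ≠ 0 → j ≠ 0 →
      (a * s ^ j).primeFactors = insert s a.primeFactors := fun {a j} ha hj => by
    rw [Nat.primeFactors_mul ha (pow_ne_zero _ hs.ne_zero), Nat.primeFactors_prime_pow hj hs,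
      Finset.union_comm, Finset.insert_eq]
  rw [← Finset.prod_product', unitaryCyclotomic]
  symm
  refine Finset.prod_bij (fun x _ => x.1 * s ^ (x.2 + 1)) ?_ ?_ ?_ (fun _ _ => rfl)
  · rintro ⟨d, i⟩ h
    simp only [Finset.mem_product, Finset.mem_filter, Nat.mem_divisors, Finset.mem_range] at h ⊢
    obtain ⟨⟨⟨hdm, -⟩, hd⟩, hi⟩ := h
    refine ⟨⟨mul_dvd_mul hdm (pow_dvd_pow _ hi), mul_ne_zero hm (pow_ne_zero _ hs.ne_zero)⟩, ?_⟩
    rw [hpf (ne_zero_of_dvd_ne_zero hm hdm) (Nat.succ_ne_zero i), hpf hm hk, hd]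
  · rintro ⟨d, i⟩ h ⟨e, j⟩ h' heq
    simp only [Finset.mem_product, Finset.mem_filter, Nat.mem_divisors] at h h' heq
    have hfac : ∀ {a l : ℕ}, a ∣ m → (a * s ^ l).factorization s = l := fun {a l} ha => by
      rw [Nat.factorization_mul (ne_zero_of_dvd_ne_zero hm ha) (pow_ne_zero _ hs.ne_zero)]
      simp [hs.factorization_pow,
        Nat.factorization_eq_zero_of_not_dvd fun hsa => hsm (hsa.trans ha)]
    have hij : i = j := by
      have := congrArg (fun n => n.factorization s) heq
      simpa only [hfac h.1.1.1, hfac h'.1.1.1, add_left_inj] using this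
    subst hij
    rw [Nat.eq_of_mul_eq_mul_right (pow_pos hs.pos _) heq]
  · intro n hn
    simp only [Finset.mem_filter, Nat.mem_divisors] at hn
    obtain ⟨⟨hdvd, -⟩, hrad⟩ := hn
    obtain ⟨a, b, ha, hb, rfl⟩ := exists_dvd_and_dvd_of_dvd_mul hdvd
    obtain ⟨j, hj, rfl⟩ := (Nat.dvd_prime_pow hs).1 hb
    have ha0 := ne_zero_of_dvd_ne_zero hm ha
    have hsa : s ∉ a.primeFactors := fun h => hs' (Nat.primeFactors_mono ha hm h)
    rw [hpf hm hk] at hrad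
    obtain _ | j := j
    · rw [pow_zero, mul_one] at hrad
      exact absurd (hrad ▸ Finset.mem_insert_self _ _) hsa
    · rw [hpf ha0 j.succ_ne_zero] at hrad
      refine ⟨(a, j), ?_, rfl⟩
      simp only [Finset.mem_product, Finset.mem_filter, Nat.mem_divisors, Finset.mem_range]
      refine ⟨⟨⟨ha, hm⟩, ?_⟩, hj⟩
      rw [← Finset.erase_insert hsa, hrad, Finset.erase_insert hs']

theorem unitaryCyclotomic_comp_X_pow {m r : ℕ} (hm : m ≠ 0) (hr : IsPrimePow r)
    (hmr : m.Coprime r) :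
    (unitaryCyclotomic m).comp (X ^ r) = unitaryCyclotomic m * unitaryCyclotomic (m * r) := by
  obtain ⟨s, k, hs, hk, rfl⟩ := (isPrimePow_nat_iff r).1 hr
  have hsm : ¬ s ∣ m :=
    (hs.coprime_iff_not_dvd).1 ((Nat.coprime_pow_right_iff hk _ _).1 hmr).symm
  rw [unitaryCyclotomic_mul_prime_pow hs hm hsm hk.ne', ← expand_eq_comp_X_pow, unitaryCyclotomic,
    map_prod, ← Finset.prod_mul_distrib]
  refine Finset.prod_congr rfl fun d hd => ?_
  have hdm : d ∣ m := Nat.dvd_of_mem_divisors (Finset.mem_filter.1 hd).1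
  rw [expand_prime_pow_cyclotomic hs (fun h => hsm (h.trans hdm)), Finset.prod_range_succ',
    pow_zero, mul_one, mul_comm]

/-- For pairwise coprime prime powers `p, q, r > 1`:
`Ψ*_{pqr}(X) = Φ*_{pq}(X) · Ψ*_{pq}(X^r)`. -/
theorem unitaryCyclotomicInv_three_prime_powers (p q r : ℕ)
    (hp : IsPrimePow p) (hq : IsPrimePow q) (hr : IsPrimePow r)
    (hpq : Nat.Coprime p q) (hpr : Nat.Coprime p r) (hqr : Nat.Coprime q r) :
    unitaryCyclotomicInv (p * q * r) =
      unitaryCyclotomic (p * q) * (unitaryCyclotomicInv (p * q)).comp (X ^ r) := by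
  have hm : 0 < p * q := Nat.mul_pos hp.pos hq.pos
  apply mul_left_cancel₀ (unitaryCyclotomic_monic (p * q * r)).ne_zero
  rw [unitaryCyclotomic_mul_unitaryCyclotomicInv (Nat.mul_pos hm hr.pos), ← mul_assoc,
    mul_comm (unitaryCyclotomic (p * q * r)),
    ← unitaryCyclotomic_comp_X_pow hm.ne' hr (hpr.mul_left hqr), ← mul_comp,
    unitaryCyclotomic_mul_unitaryCyclotomicInv hm]
  simp [← pow_mul, mul_comm r]
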